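/- arXiv:2008.11020 — 3 statements merged into one kernel-verified Lean document; each statement's English description precedes it below -/
import Mathlib

section
/- For real numbers k, v, y, s, t with k+v+y+s+t ≠ 0, v+y ≠ 0, v ≠ y, s+t ≠ 0, and s ≠ t, the 9×9 matrix F_9(k,v,y,s,t) has rank exactly 5. -/
open Matrix Polynomial

/-- Frierson's order-3 pattern `M(v,y)`. -/
def Mmat (v y : ℝ) : Matrix (Fin 3) (Fin 3) ℝ :=
  !![2*v+y, 0, v+2*y; 2*y, v+y, 2*v; v, 2*v+2*y, y]

/-- Frierson's order-9 compound square
`F_9(k,v,y,s,t) = k•E_9 + E_3 ⊗ M(v,y) + M(s,t) ⊗ E_3`: its 3×3 block in block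
position `(a,b)` (occupying rows `3a+i`, columns `3b+j`) is
`M(v,y) + (k + M(s,t)_{a,b}) • E_3`. -/
def F9 (k v y s t : ℝ) : Matrix (Fin 9) (Fin 9) ℝ :=
  Matrix.of fun i j =>
    k + Mmat v y ⟨i.val % 3, by omega⟩ ⟨j.val % 3, by omega⟩
      + Mmat s t ⟨i.val / 3, by omega⟩ ⟨j.val / 3, by omega⟩

/-- Columns: a basis of the functions `f a + g i` of the block index `a` and inner index `i`. -/
def additiveBasis : Matrix (Fin 9) (Fin 5) ℝ :=
  !![1, 1, 0, 1, 0;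
     1, 1, 0, 0, 1;
     1, 1, 0, 0, 0;
     1, 0, 1, 1, 0;
     1, 0, 1, 0, 1;
     1, 0, 1, 0, 0;
     1, 0, 0, 1, 0;
     1, 0, 0, 0, 1;
     1, 0, 0, 0, 0]

/-- A left inverse of `additiveBasis`. -/
def additiveBasisInv : Matrix (Fin 5) (Fin 9) ℝ :=
  !![0, 0, 0, 0, 0, 0, 0, 0, 1;
     0, 0, 1, 0, 0, 0, 0, 0, -1;
     0, 0, 0, 0, 0, 1, 0, 0, -1;
     0, 0, 0, 0, 0, 0, 1, 0, -1;
     0, 0, 0, 0, 0, 0, 0, 1, -1]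

/-- The Gram-type matrix of `F9` with respect to `additiveBasis`. -/
def F9Core (k v y s t : ℝ) : Matrix (Fin 5) (Fin 5) ℝ :=
  !![k + y + t, s - t, 2*s + t, v - y, 2*v + y;
     s + t, 0, -3*s - 3*t, 0, 0;
     2*s - t, 3*t - 3*s, -3*s, 0, 0;
     v + y, 0, 0, 0, -3*v - 3*y;
     2*v - y, 0, 0, 3*y - 3*v, -3*v]

lemma additiveBasisInv_mul : additiveBasisInv * additiveBasis = 1 := by
  ext i j
  fin_cases i <;> fin_cases j <;>
    simp [additiveBasisInv, additiveBasis, Matrix.mul_apply, Fin.sum_univ_succ]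

set_option maxHeartbeats 2000000 in
lemma F9_eq_mul (k v y s t : ℝ) :
    F9 k v y s t = additiveBasis * F9Core k v y s t * additiveBasisᵀ := by
  ext i j
  fin_cases i <;> fin_cases j <;>
    simp [F9, Mmat, F9Core, additiveBasis, Matrix.mul_apply, Fin.sum_univ_succ] <;> ring

lemma det_F9Core (k v y s t : ℝ) :
    (F9Core k v y s t).det =
      81 * (k + v + y + s + t) * ((v + y) * (v - y)) * ((s + t) * (s - t)) := by
  simp [F9Core, Matrix.det_succ_row_zero, Fin.sum_univ_succ, Fin.succAbove]
  ring

/-- if `k+v+y+s+t ≠ 0`, `v+y ≠ 0`, `v ≠ y`, `s+t ≠ 0` and `s ≠ t`,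
then the 9×9 matrix `F_9(k,v,y,s,t)` has rank exactly 5. -/
theorem F9_rank_five (k v y s t : ℝ) (h1 : k + v + y + s + t ≠ 0)
    (h2 : v + y ≠ 0) (h3 : v ≠ y) (h4 : s + t ≠ 0) (h5 : s ≠ t) :
    (F9 k v y s t).rank = 5 := by
  have hunit : IsUnit (F9Core k v y s t) := by
    rw [Matrix.isUnit_iff_isUnit_det, isUnit_iff_ne_zero, det_F9Core]
    have := sub_ne_zero.mpr h3
    have := sub_ne_zero.mpr h5
    positivity
  have hcore : F9Core k v y s t =
      additiveBasisInv * F9 k v y s t * additiveBasisInvᵀ := by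
    have hT : additiveBasisᵀ * additiveBasisInvᵀ = 1 := by
      rw [← Matrix.transpose_mul, additiveBasisInv_mul, Matrix.transpose_one]
    rw [F9_eq_mul, Matrix.mul_assoc, Matrix.mul_assoc, hT, Matrix.mul_one,
      ← Matrix.mul_assoc, additiveBasisInv_mul, Matrix.one_mul]
  apply le_antisymm
  · rw [F9_eq_mul]
    exact (Matrix.rank_mul_le_left _ _).trans (Matrix.rank_le_width _)
  · calc 5 = (F9Core k v y s t).rank := by simp [Matrix.rank_of_isUnit _ hunit]
      _ ≤ (additiveBasisInv * F9 k v y s t).rank := by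
        rw [hcore]
        exact Matrix.rank_mul_le_left _ _
      _ ≤ (F9 k v y s t).rank := Matrix.rank_mul_le_right _ _
end

section
/- For all real numbers k, v, y, s, t, p, q, the 27×27 matrix F_27(k,v,y,s,t,p,q) is an associative magic square: every row sum, every column sum, and both main diagonal sums equal 27(k+v+y+s+t+p+q), and for all i, j in Fin 27 the entries at position (i,j) and at the antipodal position (26−i, 26−j) sum to 2(k+v+y+s+t+p+q). -/
open Matrix Polynomial

/-- The order-27 compound square
`F_27(k,v,y,s,t,p,q) = k•E_27 + E_3⊗E_3⊗M(v,y) + E_3⊗M(s,t)⊗E_3 + M(p,q)⊗E_3⊗E_3`: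
the entry at position `(i,j)` (with `i = 9a + 3b + c` etc.) is
`k + M(v,y)_{i%3, j%3} + M(s,t)_{i/3%3, j/3%3} + M(p,q)_{i/9, j/9}`. -/
def F27 (k v y s t p q : ℝ) : Matrix (Fin 27) (Fin 27) ℝ :=
  Matrix.of fun i j =>
    k + Mmat v y ⟨i.val % 3, by omega⟩ ⟨j.val % 3, by omega⟩
      + Mmat s t ⟨i.val / 3 % 3, by omega⟩ ⟨j.val / 3 % 3, by omega⟩
      + Mmat p q ⟨i.val / 9, by omega⟩ ⟨j.val / 9, by omega⟩

theorem sum_ternary_digits (k : ℝ) (f g h : Fin 3 → ℝ) :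
    ∑ i : Fin 27, (k + f ⟨i.val % 3, by omega⟩ + g ⟨i.val / 3 % 3, by omega⟩
      + h ⟨i.val / 9, by omega⟩) = 27 * k + 9 * (∑ a, f a + ∑ a, g a + ∑ a, h a) := by
  simp [Fin.sum_univ_succ]
  ring

theorem Mmat_row_sum (v y : ℝ) (i : Fin 3) : ∑ j, Mmat v y i j = 3 * (v + y) := by
  fin_cases i <;> simp [Mmat, Fin.sum_univ_three] <;> ring

theorem Mmat_col_sum (v y : ℝ) (j : Fin 3) : ∑ i, Mmat v y i j = 3 * (v + y) := by
  fin_cases j <;> simp [Mmat, Fin.sum_univ_three] <;> ring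

theorem Mmat_diag_sum (v y : ℝ) : ∑ i, Mmat v y i i = 3 * (v + y) := by
  simp [Mmat, Fin.sum_univ_three]
  ring

theorem Mmat_antidiag_sum (v y : ℝ) : ∑ i, Mmat v y i i.rev = 3 * (v + y) := by
  simp [Mmat, Fin.sum_univ_three, Fin.rev]
  ring

theorem Mmat_add_antipode (v y : ℝ) (i j : Fin 3) :
    Mmat v y i j + Mmat v y i.rev j.rev = 2 * (v + y) := by
  fin_cases i <;> fin_cases j <;> simp [Mmat, Fin.rev] <;> ring

theorem ternary_digits_antipode (i : Fin 27) :
    (⟨(26 - i).val % 3, by omega⟩ : Fin 3) = Fin.rev ⟨i.val % 3, by omega⟩ ∧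
    (⟨(26 - i).val / 3 % 3, by omega⟩ : Fin 3) = Fin.rev ⟨i.val / 3 % 3, by omega⟩ ∧
    (⟨(26 - i).val / 9, by omega⟩ : Fin 3) = Fin.rev ⟨i.val / 9, by omega⟩ := by
  revert i
  decide

/-- `F_27(k,v,y,s,t,p,q)` is an associative magic square: every
row sum, column sum and both main diagonal sums equal `27(k+v+y+s+t+p+q)`, and
antipodal entries sum to `2(k+v+y+s+t+p+q)`. -/
theorem F27_is_associative_magic (k v y s t p q : ℝ) :
    (∀ i : Fin 27, ∑ j : Fin 27, F27 k v y s t p q i j =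
      27 * (k + v + y + s + t + p + q)) ∧
    (∀ j : Fin 27, ∑ i : Fin 27, F27 k v y s t p q i j =
      27 * (k + v + y + s + t + p + q)) ∧
    (∑ i : Fin 27, F27 k v y s t p q i i =
      27 * (k + v + y + s + t + p + q)) ∧
    (∑ i : Fin 27, F27 k v y s t p q i (26 - i) =
      27 * (k + v + y + s + t + p + q)) ∧
    (∀ i j : Fin 27, F27 k v y s t p q i j + F27 k v y s t p q (26 - i) (26 - j) =
      2 * (k + v + y + s + t + p + q)) := by
  refine ⟨fun i => ?_, fun j => ?_, ?_, ?_, fun i j => ?_⟩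
  · refine (sum_ternary_digits k (Mmat v y _) (Mmat s t _) (Mmat p q _)).trans ?_
    simp only [Mmat_row_sum]
    ring
  · refine (sum_ternary_digits k (Mmat v y · _) (Mmat s t · _) (Mmat p q · _)).trans ?_
    simp only [Mmat_col_sum]
    ring
  · refine (sum_ternary_digits k (fun a => Mmat v y a a) (fun a => Mmat s t a a)
      (fun a => Mmat p q a a)).trans ?_
    simp only [Mmat_diag_sum]
    ring
  · simp only [F27, Matrix.of_apply, ternary_digits_antipode]
    refine (sum_ternary_digits k (fun a => Mmat v y a a.rev) (fun a => Mmat s t a a.rev)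
      (fun a => Mmat p q a a.rev)).trans ?_
    simp only [Mmat_antidiag_sum]
    ring
  · simp only [F27, Matrix.of_apply, ternary_digits_antipode]
    linear_combination Mmat_add_antipode v y ⟨i.val % 3, by omega⟩ ⟨j.val % 3, by omega⟩
      + Mmat_add_antipode s t ⟨i.val / 3 % 3, by omega⟩ ⟨j.val / 3 % 3, by omega⟩
      + Mmat_add_antipode p q ⟨i.val / 9, by omega⟩ ⟨j.val / 9, by omega⟩
end

section
/- For all real numbers k, v, y, s, t, p, q, the characteristic polynomial of the 27×27 Gram matrix F_27(k,v,y,s,t,p,q) * (F_27(k,v,y,s,t,p,q))ᵀ equals X²⁰ · (X − 729(k+v+y+s+t+p+q)²) · (X − 243(v+y)²) · (X − 243(v−y)²) · (X − 243(s+t)²) · (X − 243(s−t)²) · (X − 243(p+q)²) · (X − 243(p−q)²); consequently F_27 has at most 7 nonzero singular values, and rank at most 7. -/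
open Matrix Polynomial

/-- The antisymmetric vector `(1, 0, -1)`. -/
def altVec : Fin 3 → ℤ := ![1, 0, -1]

/-- The symmetric zero-sum vector `(1, -2, 1)`. -/
def symVec : Fin 3 → ℤ := ![1, -2, 1]

/-- Seven pairwise orthogonal vectors, written as columns, which span the row and column spaces of
every `F27`. -/
def basisMat : Matrix (Fin 27) (Fin 7) ℤ :=
  Matrix.of fun i =>
    ![1, altVec ⟨i.val % 3, by omega⟩, symVec ⟨i.val % 3, by omega⟩,
      altVec ⟨i.val / 3 % 3, by omega⟩, symVec ⟨i.val / 3 % 3, by omega⟩,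
      altVec ⟨i.val / 9, by omega⟩, symVec ⟨i.val / 9, by omega⟩]

/-- The matrix of `F27` with respect to the columns of `basisMat`. -/
noncomputable def coeffMat (k v y s t p q : ℝ) : Matrix (Fin 7) (Fin 7) ℝ :=
  !![k + v + y + s + t + p + q, 0, 0, 0, 0, 0, 0;
     0, 0, (v + y) / 2, 0, 0, 0, 0;
     0, (v - y) / 2, 0, 0, 0, 0, 0;
     0, 0, 0, 0, (s + t) / 2, 0, 0;
     0, 0, 0, (s - t) / 2, 0, 0, 0;
     0, 0, 0, 0, 0, 0, (p + q) / 2;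
     0, 0, 0, 0, 0, (p - q) / 2, 0]

theorem basisMat_transpose_mul_self :
    basisMatᵀ * basisMat = diagonal ![27, 18, 54, 18, 54, 18, 54] := by
  ext i j
  rw [Matrix.mul_apply, Fin.sum_univ_def]
  fin_cases i <;> fin_cases j <;> rfl

theorem basisMat_map_transpose_mul_self :
    (basisMat.map ((↑) : ℤ → ℝ))ᵀ * basisMat.map ((↑) : ℤ → ℝ) =
      diagonal ![27, 18, 54, 18, 54, 18, 54] := by
  have h := congrArg (fun A => A.map (Int.castRingHom ℝ)) basisMat_transpose_mul_self
  simp only [Matrix.map_mul, Matrix.diagonal_map, map_zero] at h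
  refine Eq.trans h (congrArg diagonal ?_)
  funext i
  fin_cases i <;> simp

theorem Mmat_apply (v y : ℝ) (i j : Fin 3) :
    Mmat v y i j = v + y + (v + y) / 2 * (altVec i * symVec j) +
      (v - y) / 2 * (symVec i * altVec j) := by
  fin_cases i <;> fin_cases j <;> simp [Mmat, altVec, symVec] <;> ring

theorem F27_eq_basisMat_mul (k v y s t p q : ℝ) :
    F27 k v y s t p q = basisMat.map ((↑) : ℤ → ℝ) *
      (coeffMat k v y s t p q * (basisMat.map ((↑) : ℤ → ℝ))ᵀ) := by
  ext i j
  simp [F27, Mmat_apply, Matrix.mul_apply, Matrix.vecMul, dotProduct, Fin.sum_univ_succ, coeffMat,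
    basisMat]
  ring

theorem coeffMat_gram (k v y s t p q : ℝ) :
    coeffMat k v y s t p q * diagonal ![27, 18, 54, 18, 54, 18, 54] *
        (coeffMat k v y s t p q)ᵀ * diagonal ![27, 18, 54, 18, 54, 18, 54] =
      diagonal ![729 * (k + v + y + s + t + p + q) ^ 2, 243 * (v + y) ^ 2, 243 * (v - y) ^ 2,
        243 * (s + t) ^ 2, 243 * (s - t) ^ 2, 243 * (p + q) ^ 2, 243 * (p - q) ^ 2] := by
  ext i j
  rw [Matrix.mul_diagonal, Matrix.mul_apply]
  simp only [Matrix.mul_diagonal, Matrix.transpose_apply]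
  fin_cases i <;> fin_cases j <;> simp [coeffMat, Fin.sum_univ_succ] <;> ring

theorem charpoly_diagonal_seven (a b c d e f g : ℝ) :
    (diagonal ![a, b, c, d, e, f, g]).charpoly =
      (X - C a) * (X - C b) * (X - C c) * (X - C d) * (X - C e) * (X - C f) * (X - C g) := by
  rw [Matrix.charpoly_diagonal, Fin.prod_univ_seven]
  simp only [Matrix.cons_val]

theorem F27_rank_le (k v y s t p q : ℝ) : (F27 k v y s t p q).rank ≤ 7 := by
  rw [F27_eq_basisMat_mul]
  refine (Matrix.rank_mul_le_left _ _).trans ?_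
  simpa using Matrix.rank_le_card_width (basisMat.map ((↑) : ℤ → ℝ))

theorem F27_gram_eq (k v y s t p q : ℝ) :
    F27 k v y s t p q * (F27 k v y s t p q)ᵀ =
      basisMat.map ((↑) : ℤ → ℝ) * (coeffMat k v y s t p q *
        diagonal ![27, 18, 54, 18, 54, 18, 54] * (coeffMat k v y s t p q)ᵀ *
          (basisMat.map ((↑) : ℤ → ℝ))ᵀ) := by
  simp only [F27_eq_basisMat_mul, ← basisMat_map_transpose_mul_self, Matrix.transpose_mul,
    Matrix.transpose_transpose, Matrix.mul_assoc]

theorem charpoly_mul_eq_X_pow_twenty_mul (A : Matrix (Fin 27) (Fin 7) ℝ)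
    (B : Matrix (Fin 7) (Fin 27) ℝ) :
    (A * B).charpoly = X ^ 20 * (B * A).charpoly := by
  have h : Fintype.card (Fin 27) - Fintype.card (Fin 7) = 20 := by simp
  rw [Matrix.charpoly_mul_comm_of_le A B (by simp), h]

theorem coeffMat_gram_mul_basisMat (k v y s t p q : ℝ) :
    coeffMat k v y s t p q * diagonal ![27, 18, 54, 18, 54, 18, 54] *
        (coeffMat k v y s t p q)ᵀ * (basisMat.map ((↑) : ℤ → ℝ))ᵀ * basisMat.map ((↑) : ℤ → ℝ) =
      diagonal ![729 * (k + v + y + s + t + p + q) ^ 2, 243 * (v + y) ^ 2, 243 * (v - y) ^ 2,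
        243 * (s + t) ^ 2, 243 * (s - t) ^ 2, 243 * (p + q) ^ 2, 243 * (p - q) ^ 2] :=
  (Matrix.mul_assoc _ _ _).trans <|
    (congrArg _ basisMat_map_transpose_mul_self).trans (coeffMat_gram k v y s t p q)

/-- the characteristic polynomial of the 27×27 Gram matrix
`F_27 * F_27ᵀ` equals
`X²⁰·(X − 729(k+v+y+s+t+p+q)²)·(X − 243(v+y)²)·(X − 243(v−y)²)·(X − 243(s+t)²)·(X − 243(s−t)²)·(X − 243(p+q)²)·(X − 243(p−q)²)`;
consequently `F_27` has at most 7 nonzero singular values, i.e. rank at most 7. -/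
theorem F27_gram_charpoly (k v y s t p q : ℝ) :
    (F27 k v y s t p q * (F27 k v y s t p q)ᵀ).charpoly =
      X ^ 20 * (X - C (729 * (k + v + y + s + t + p + q) ^ 2)) *
        (X - C (243 * (v + y) ^ 2)) * (X - C (243 * (v - y) ^ 2)) *
        (X - C (243 * (s + t) ^ 2)) * (X - C (243 * (s - t) ^ 2)) *
        (X - C (243 * (p + q) ^ 2)) * (X - C (243 * (p - q) ^ 2)) ∧
    (F27 k v y s t p q).rank ≤ 7 := by
  refine ⟨?_, F27_rank_le k v y s t p q⟩
  rw [F27_gram_eq, charpoly_mul_eq_X_pow_twenty_mul, coeffMat_gram_mul_basisMat,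
    charpoly_diagonal_seven]
  simp only [mul_assoc]
end
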